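/- Let G be a finite graph with independent edge percolation (each edge e open with probability p(e)), let 0 and b be vertices and A = {a₁, a₂} a set of two vertices. Then P(0↔b, 0↔A) ≥ min{ P(0↔A, a₁↔b), P(0↔A, a₂↔b) }. -/

import Mathlib

open scoped BigOperators

structure PercGraph (V E : Type) where
  ends : E → V × V
  p : E → ℝ

namespace PercGraph

variable {V E : Type} [DecidableEq V] [Fintype E] [DecidableEq E]

/-- Weight of a configuration: each edge `e` is open (`ω e = true`) with probability `p e`. -/
def weight (G : PercGraph V E) (ω : E → Bool) : ℝ :=
  ∏ e, if ω e then G.p e else 1 - G.p e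

/-- Probability of an event under the percolation measure. -/
noncomputable def prob (G : PercGraph V E) (S : Set (E → Bool)) : ℝ :=
  ∑ ω : E → Bool, Set.indicator S G.weight ω

/-- Expectation of a function under the percolation measure. -/
noncomputable def expec (G : PercGraph V E) (f : (E → Bool) → ℝ) : ℝ :=
  ∑ ω : E → Bool, f ω * G.weight ω

/-- Two vertices are adjacent via an open edge in configuration `ω`. -/
def adj (G : PercGraph V E) (ω : E → Bool) (x y : V) : Prop :=
  ∃ e, ω e = true ∧ (G.ends e = (x, y) ∨ G.ends e = (y, x))

/-- `x` and `y` are connected by a path of open edges. -/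
def Conn (G : PercGraph V E) (ω : E → Bool) (x y : V) : Prop :=
  Relation.ReflTransGen (G.adj ω) x y

/-- The union of the open clusters of the vertices of `A`. -/
def cluster (G : PercGraph V E) (ω : E → Bool) (A : Set V) : Set V :=
  {y | ∃ a ∈ A, G.Conn ω a y}

/-- The event `x ↔ y`. -/
def connEvent (G : PercGraph V E) (x y : V) : Set (E → Bool) :=
  {ω | G.Conn ω x y}

/-- The event `x ↔ A`. -/
def connTo (G : PercGraph V E) (x : V) (A : Set V) : Set (E → Bool) :=
  {ω | ∃ a ∈ A, G.Conn ω x a}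

/-- The event `A ↮ B`. -/
def disconn (G : PercGraph V E) (A B : Set V) : Set (E → Bool) :=
  {ω | ∀ a ∈ A, ∀ b ∈ B, ¬ G.Conn ω a b}

def IncreasingEvent (S : Set (E → Bool)) : Prop :=
  ∀ ⦃ω ω' : E → Bool⦄, (∀ e, ω e = true → ω' e = true) → ω ∈ S → ω' ∈ S

def DecreasingEvent (S : Set (E → Bool)) : Prop :=
  ∀ ⦃ω ω' : E → Bool⦄, (∀ e, ω e = true → ω' e = true) → ω' ∈ S → ω ∈ S

def IncreasingFun (f : (E → Bool) → ℝ) : Prop :=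
  ∀ ⦃ω ω' : E → Bool⦄, (∀ e, ω e = true → ω' e = true) → f ω ≤ f ω'

/-- `f` is determined by the cluster of `A`. -/
def ClusterDetermined (G : PercGraph V E) (A : Set V) (f : (E → Bool) → ℝ) : Prop :=
  ∀ ω ω', G.cluster ω A = G.cluster ω' A → f ω = f ω'

/-- The event `S` is determined by the cluster of `A`. -/
def ClusterDeterminedEvent (G : PercGraph V E) (A : Set V) (S : Set (E → Bool)) : Prop :=
  ∀ ω ω', G.cluster ω A = G.cluster ω' A → (ω ∈ S ↔ ω' ∈ S)

noncomputable def condProb (G : PercGraph V E) (S T : Set (E → Bool)) : ℝ :=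
  G.prob (S ∩ T) / G.prob T

noncomputable def condExpec (G : PercGraph V E) (f : (E → Bool) → ℝ) (T : Set (E → Bool)) : ℝ :=
  G.expec (T.indicator f) / G.prob T

/-- The edge `e` is incident to the vertex `x`. -/
def incident (G : PercGraph V E) (x : V) (e : E) : Prop :=
  (G.ends e).1 = x ∨ (G.ends e).2 = x

/-- The other endpoint of an edge incident to `x`. -/
def otherEnd (G : PercGraph V E) (x : V) (e : E) : V :=
  if (G.ends e).1 = x then (G.ends e).2 else (G.ends e).1

/-- The graph `G ∖ W`: delete the vertices of `W` and all incident edges. -/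
def delete (G : PercGraph V E) (W : Finset V) :
    PercGraph V {e : E // (G.ends e).1 ∉ W ∧ (G.ends e).2 ∉ W} :=
  ⟨fun e => G.ends e.1, fun e => G.p e.1⟩

/-- The graph `G` with the probability of edge `e` replaced by `q`. -/
def withEdgeProb (G : PercGraph V E) (e : E) (q : ℝ) : PercGraph V E :=
  ⟨G.ends, Function.update G.p e q⟩

/-- Contraction of the edge `e`: set its probability to 1. -/
def contract (G : PercGraph V E) (e : E) : PercGraph V E :=
  G.withEdgeProb e 1

/-- The event that `e` is pivotal for `U`. -/
def pivotal (e : E) (U : Set (E → Bool)) : Set (E → Bool) :=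
  {ω | ¬ ((Function.update ω e true ∈ U) ↔ (Function.update ω e false ∈ U))}

/-- All edge probabilities lie in `[0,1]`. -/
def ProbValid (G : PercGraph V E) : Prop := ∀ e, 0 ≤ G.p e ∧ G.p e ≤ 1

end PercGraph

namespace PercGraph

section Expectation

variable {V E : Type} [Fintype E]

lemma weight_nonneg (G : PercGraph V E) (hp : G.ProbValid) (ω : E → Bool) : 0 ≤ G.weight ω := by
  refine Finset.prod_nonneg fun e _ => ?_
  split_ifs
  · exact (hp e).1
  · linarith [(hp e).2]

lemma weight_mul_weight (G : PercGraph V E) (ω ω' : E → Bool) :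
    G.weight ω * G.weight ω' = G.weight (ω ⊓ ω') * G.weight (ω ⊔ ω') := by
  simp only [weight, ← Finset.prod_mul_distrib]
  refine Finset.prod_congr rfl fun e _ => ?_
  cases h : ω e <;> cases h' : ω' e <;> simp [h, h', mul_comm]

variable [DecidableEq E]

lemma weight_update (G : PercGraph V E) (ω : E → Bool) (e : E) (c : Bool) :
    G.weight (Function.update ω e c) =
      (if c then G.p e else 1 - G.p e) *
        ∏ e' ∈ Finset.univ.erase e, if ω e' then G.p e' else 1 - G.p e' := by
  rw [weight, ← Finset.mul_prod_erase _ _ (Finset.mem_univ e), Function.update_self]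
  congr 1
  refine Finset.prod_congr rfl fun e' he' => ?_
  rw [Function.update_of_ne (Finset.ne_of_mem_erase he')]

lemma expec_mono (G : PercGraph V E) (hp : G.ProbValid) {f g : (E → Bool) → ℝ}
    (h : ∀ ω, f ω ≤ g ω) : G.expec f ≤ G.expec g :=
  Finset.sum_le_sum fun ω _ => mul_le_mul_of_nonneg_right (h ω) (G.weight_nonneg hp ω)

lemma expec_nonneg (G : PercGraph V E) (hp : G.ProbValid) {f : (E → Bool) → ℝ}
    (h : ∀ ω, 0 ≤ f ω) : 0 ≤ G.expec f :=
  Finset.sum_nonneg fun ω _ => mul_nonneg (h ω) (G.weight_nonneg hp ω)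

lemma expec_add (G : PercGraph V E) (f g : (E → Bool) → ℝ) :
    G.expec (fun ω => f ω + g ω) = G.expec f + G.expec g := by
  simp only [expec, add_mul, Finset.sum_add_distrib]

lemma expec_sub (G : PercGraph V E) (f g : (E → Bool) → ℝ) :
    G.expec (fun ω => f ω - g ω) = G.expec f - G.expec g := by
  simp only [expec, sub_mul, Finset.sum_sub_distrib]

/-- Conditioning on the state of a single edge. -/
lemma expec_update (G : PercGraph V E) (f : (E → Bool) → ℝ) (e : E) :
    G.expec f = G.p e * G.expec (fun ω => f (Function.update ω e true)) +
      (1 - G.p e) * G.expec (fun ω => f (Function.update ω e false)) := by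
  have flip : Function.Involutive fun ω : E → Bool => Function.update ω e (!ω e) := by
    intro ω; simp
  have pair (g : (E → Bool) → ℝ) : 2 * ∑ ω, g ω =
      ∑ ω, (g (Function.update ω e true) + g (Function.update ω e false)) := by
    rw [two_mul]
    nth_rewrite 2 [← Equiv.sum_comp flip.toPerm]
    rw [← Finset.sum_add_distrib]
    refine Finset.sum_congr rfl fun ω _ => ?_
    have self := Function.update_eq_self e ω
    cases h : ω e <;> rw [h] at self <;>
      simp only [Function.Involutive.coe_toPerm, h, Bool.not_true, Bool.not_false, self]
    exact add_comm _ _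
  have : 2 * G.expec f = 2 * (G.p e * G.expec (fun ω => f (Function.update ω e true)) +
      (1 - G.p e) * G.expec (fun ω => f (Function.update ω e false))) := by
    simp only [expec, mul_add, mul_left_comm (2 : ℝ), pair]
    rw [Finset.mul_sum, Finset.mul_sum, ← Finset.sum_add_distrib]
    refine Finset.sum_congr rfl fun ω _ => ?_
    simp only [weight_update, Function.update_idem, if_true, Bool.false_eq_true, if_false]
    ring
  linarith

/-- The Harris inequality. -/
lemma expec_mul_expec_le (G : PercGraph V E) (hp : G.ProbValid) {f g : (E → Bool) → ℝ}
    (hf₀ : 0 ≤ f) (hg₀ : 0 ≤ g) (hf : Monotone f) (hg : Monotone g) :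
    G.expec f * G.expec g ≤ G.expec (fun _ => 1) * G.expec (fun ω => f ω * g ω) := by
  have := fkg (μ := G.weight) (f := f) (g := g) (hμ₀ := G.weight_nonneg hp) (hf₀ := hf₀)
    (hg₀ := hg₀) (hf := hf) (hg := hg) <| fun ω ω' => (G.weight_mul_weight ω ω').le
  simpa only [expec, mul_comm, mul_one, one_mul] using this

lemma prob_eq_expec (G : PercGraph V E) (S : Set (E → Bool)) :
    G.prob S = G.expec (S.indicator 1) := by
  refine Finset.sum_congr rfl fun ω _ => ?_
  by_cases h : ω ∈ S <;> simp [h]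

end Expectation

section Cluster

variable {V E : Type} (G : PercGraph V E)

lemma adj_symm {ω : E → Bool} {u v : V} (h : G.adj ω u v) : G.adj ω v u := by
  obtain ⟨e, he, h⟩ := h
  exact ⟨e, he, h.symm⟩

lemma Conn.symm {G : PercGraph V E} {ω : E → Bool} {u v : V} (h : G.Conn ω u v) :
    G.Conn ω v u := by
  unfold Conn at h ⊢
  induction h with
  | refl => exact .refl
  | tail _ hbc ih => exact .head (G.adj_symm hbc) ih

lemma Conn.mono {G : PercGraph V E} {ω ω' : E → Bool} (hω : ω ≤ ω') {u v : V}
    (h : G.Conn ω u v) : G.Conn ω' u v := by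
  refine Relation.ReflTransGen.mono ?_ _ _ h
  rintro a c ⟨e, he, h⟩
  exact ⟨e, hω e he, h⟩

lemma cluster_mono {ω ω' : E → Bool} (hω : ω ≤ ω') (A : Set V) :
    G.cluster ω A ⊆ G.cluster ω' A := fun _ ⟨a, ha, h⟩ => ⟨a, ha, h.mono hω⟩

lemma cluster_subset_cluster {ω : E → Bool} {A B : Set V} (h : A ⊆ B) :
    G.cluster ω A ⊆ G.cluster ω B := fun _ ⟨a, ha, hc⟩ => ⟨a, h ha, hc⟩

lemma subset_cluster (ω : E → Bool) (A : Set V) : A ⊆ G.cluster ω A :=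
  fun a ha => ⟨a, ha, .refl⟩

lemma cluster_subset_of_closed {ω : E → Bool} {A B : Set V} (hAB : A ⊆ B)
    (h : ∀ u ∈ B, ∀ v, G.adj ω u v → v ∈ B) : G.cluster ω A ⊆ B := by
  rintro y ⟨a, ha, hc⟩
  unfold Conn at hc
  induction hc with
  | refl => exact hAB ha
  | tail _ hbc ih => exact h _ ih _ hbc

lemma mem_cluster_of_adj {ω : E → Bool} {A : Set V} {u v : V} (hu : u ∈ G.cluster ω A)
    (h : G.adj ω u v) : v ∈ G.cluster ω A :=
  let ⟨a, ha, hc⟩ := hu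
  ⟨a, ha, hc.tail h⟩

lemma mem_cluster_singleton {ω : E → Bool} {x y : V} : y ∈ G.cluster ω {x} ↔ G.Conn ω x y := by
  simp [cluster]

variable [DecidableEq E]

lemma adj_update {ω : E → Bool} {e : E} {s t u v : V} (he : G.ends e = (s, t) ∨ G.ends e = (t, s))
    (h : G.adj (Function.update ω e true) u v) :
    G.adj ω u v ∨ (u = s ∧ v = t) ∨ (u = t ∧ v = s) := by
  obtain ⟨e', he', h⟩ := h
  by_cases hee : e' = e
  · subst hee
    right
    rcases he with he | he <;> rw [he] at h <;> simp only [Prod.mk.injEq] at h <;> tauto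
  · rw [Function.update_of_ne hee] at he'
    exact .inl ⟨e', he', h⟩

lemma adj_update_self {ω : E → Bool} {e : E} {s t : V}
    (he : G.ends e = (s, t) ∨ G.ends e = (t, s)) :
    G.adj (Function.update ω e true) s t := ⟨e, by simp, he⟩

lemma le_update_true (ω : E → Bool) (e : E) : ω ≤ Function.update ω e true := by
  intro e'
  by_cases h : e' = e
  · subst h; simp
  · simp [Function.update_of_ne h]

/-- Opening an edge from `t ∈ T` to `v` enlarges the cluster of `T` to that of `T ∪ {v}`. -/
lemma cluster_update {ω : E → Bool} {e : E} {t v : V} {T : Set V} (ht : t ∈ T)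
    (he : G.ends e = (t, v) ∨ G.ends e = (v, t)) :
    G.cluster (Function.update ω e true) T = G.cluster ω (insert v T) := by
  apply Set.Subset.antisymm
  · refine G.cluster_subset_of_closed
      ((Set.subset_insert v T).trans (G.subset_cluster ω _)) fun u hu w huw => ?_
    rcases G.adj_update he huw with h | ⟨-, rfl⟩ | ⟨-, rfl⟩
    · exact G.mem_cluster_of_adj hu h
    · exact G.subset_cluster _ _ (Set.mem_insert _ _)
    · exact G.subset_cluster _ _ (Set.mem_insert_of_mem _ ht)
  · refine G.cluster_subset_of_closed ?_ fun u hu w huw => ?_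
    · refine Set.insert_subset ?_ (G.subset_cluster _ _)
      exact G.mem_cluster_of_adj (G.subset_cluster _ _ ht) (G.adj_update_self he)
    · exact G.mem_cluster_of_adj hu (huw.imp fun e' hopen =>
        ⟨le_update_true ω e e' hopen.1, hopen.2⟩)

/-- Opening an edge that does not touch the cluster of `A` does not change that cluster. -/
lemma cluster_update_of_notMem {ω : E → Bool} {e : E} {t v : V} {A : Set V}
    (ht : t ∉ G.cluster ω A) (hv : v ∉ G.cluster ω A)
    (he : G.ends e = (t, v) ∨ G.ends e = (v, t)) :
    G.cluster (Function.update ω e true) A = G.cluster ω A := by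
  refine Set.Subset.antisymm (G.cluster_subset_of_closed (G.subset_cluster ω A) fun u hu w huw => ?_)
    (G.cluster_mono (le_update_true ω e) A)
  rcases G.adj_update he huw with h | ⟨rfl, -⟩ | ⟨rfl, -⟩
  · exact G.mem_cluster_of_adj hu h
  · exact absurd hu ht
  · exact absurd hu hv

lemma disjoint_cluster_update_iff {ω : E → Bool} {e : E} {t v : V} {A T : Set V} (ht : t ∈ T)
    (he : G.ends e = (t, v) ∨ G.ends e = (v, t)) :
    Disjoint (G.cluster (Function.update ω e true) A) T ↔
      Disjoint (G.cluster ω A) (insert v T) := by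
  constructor
  · intro h
    have htA : t ∉ G.cluster (Function.update ω e true) A := fun h' =>
      Set.disjoint_left.1 h h' ht
    have hsub := G.cluster_mono (le_update_true ω e) A
    rw [Set.disjoint_insert_right]
    exact ⟨fun hv => htA (G.mem_cluster_of_adj (hsub hv) (G.adj_update_self he.symm)),
      h.mono_left hsub⟩
  · intro h
    rw [Set.disjoint_insert_right] at h
    rw [G.cluster_update_of_notMem (fun h' => Set.disjoint_left.1 h.2 h' ht) h.1 he]
    exact h.2

end Cluster

section Association

variable {V E : Type} [DecidableEq E]

/-- Close all edges outside `F`. -/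
def restrict (F : Finset E) (ω : E → Bool) : E → Bool := fun e => ω e && decide (e ∈ F)

lemma restrict_mono (F : Finset E) {ω ω' : E → Bool} (h : ω ≤ ω') :
    restrict F ω ≤ restrict F ω' := by
  intro e
  have := h e
  revert this
  cases h₁ : ω e <;> cases h₂ : ω' e <;> simp [restrict, h₁, h₂]

lemma restrict_update_true {F : Finset E} {e : E} (he : e ∈ F) (ω : E → Bool) :
    restrict F (Function.update ω e true) = Function.update (restrict (F.erase e) ω) e true := by
  ext e'
  by_cases h : e' = e
  · subst h; simp [restrict, he]
  · simp [restrict, h]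

lemma restrict_update_false (F : Finset E) (e : E) (ω : E → Bool) :
    restrict F (Function.update ω e false) = restrict (F.erase e) ω := by
  ext e'
  by_cases h : e' = e
  · subst h; simp [restrict]
  · simp [restrict, h]

variable [Fintype E]

open Classical in
/-- The expectation of `h` at the clusters of `A` and `T`, on the event `A ↮ T`, when the edges
outside `F` are closed. -/
noncomputable def disconnExpec (G : PercGraph V E) (F : Finset E) (A T : Set V)
    (h : Set V → Set V → ℝ) : ℝ :=
  G.expec fun ω => if Disjoint (G.cluster (restrict F ω) A) T then
    h (G.cluster (restrict F ω) A) (G.cluster (restrict F ω) T) else 0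

lemma disconnExpec_nonneg (G : PercGraph V E) (hp : G.ProbValid) (F : Finset E) (A T : Set V)
    {h : Set V → Set V → ℝ} (hh : ∀ C D, 0 ≤ h C D) : 0 ≤ G.disconnExpec F A T h := by
  refine G.expec_nonneg hp fun ω => ?_
  split_ifs
  · exact hh _ _
  · exact le_rfl

lemma disconnExpec_sub (G : PercGraph V E) (F : Finset E) (A T : Set V)
    (h k : Set V → Set V → ℝ) :
    G.disconnExpec F A T (fun C D => h C D - k C D) =
      G.disconnExpec F A T h - G.disconnExpec F A T k := by
  rw [disconnExpec, disconnExpec, disconnExpec, ← expec_sub]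
  congr 1
  ext ω
  split_ifs <;> simp

lemma disconnExpec_eq_zero (G : PercGraph V E) (hp : G.ProbValid) {F : Finset E} {A T : Set V}
    (h₀ : G.disconnExpec F A T (fun _ _ => 1) = 0) (h : Set V → Set V → ℝ) :
    G.disconnExpec F A T h = 0 := by
  rw [disconnExpec, expec, Finset.sum_eq_zero_iff_of_nonneg] at h₀
  · refine Finset.sum_eq_zero fun ω hω => ?_
    have := h₀ ω hω
    split_ifs at this with hd
    · rw [one_mul] at this
      rw [this, mul_zero]
    · simp only [if_neg hd, zero_mul]
  · intro ω _
    refine mul_nonneg ?_ (G.weight_nonneg hp ω)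
    split_ifs <;> norm_num

/-- Revealing an edge from `t ∈ T` to `v`. -/
lemma disconnExpec_erase (G : PercGraph V E) {F : Finset E} {A T : Set V} {e : E} {t v : V}
    (heF : e ∈ F) (ht : t ∈ T) (he : G.ends e = (t, v) ∨ G.ends e = (v, t))
    (h : Set V → Set V → ℝ) :
    G.disconnExpec F A T h = G.p e * G.disconnExpec (F.erase e) A (insert v T) h +
      (1 - G.p e) * G.disconnExpec (F.erase e) A T h := by
  classical
  rw [disconnExpec, G.expec_update _ e]
  simp only [restrict_update_true heF, restrict_update_false,
    G.disjoint_cluster_update_iff ht he, G.cluster_update ht he]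
  congr 2
  refine congrArg G.expec (funext fun ω => ?_)
  split_ifs with hd
  · rw [Set.disjoint_insert_right] at hd
    rw [G.cluster_update_of_notMem (fun h' => Set.disjoint_left.1 hd.2 h' ht) hd.1 he]
  · rfl

lemma mixture_correlation {p a₀ a₁ b₀ b₁ m₀ m₁ n₀ n₁ : ℝ} (hp₀ : 0 ≤ p) (hp₁ : p ≤ 1)
    (hn₀ : 0 ≤ n₀) (hn₁ : 0 ≤ n₁) (h₀ : a₀ * b₀ ≤ n₀ * m₀) (h₁ : a₁ * b₁ ≤ n₁ * m₁)
    (ha : a₁ * n₀ ≤ a₀ * n₁) (hb : b₁ * n₀ ≤ b₀ * n₁)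
    (hz₀ : n₀ = 0 → a₀ = 0 ∧ b₀ = 0 ∧ m₀ = 0) (hz₁ : n₁ = 0 → a₁ = 0 ∧ b₁ = 0 ∧ m₁ = 0) :
    (p * a₁ + (1 - p) * a₀) * (p * b₁ + (1 - p) * b₀) ≤
      (p * n₁ + (1 - p) * n₀) * (p * m₁ + (1 - p) * m₀) := by
  have key : a₁ * b₀ + a₀ * b₁ ≤ n₁ * m₀ + n₀ * m₁ := by
    rcases hn₀.eq_or_lt with hn | hn
    · obtain ⟨ha, hb, hm⟩ := hz₀ hn.symm
      simp [ha, hb, hm, ← hn]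
    rcases hn₁.eq_or_lt with hn' | hn'
    · obtain ⟨ha, hb, hm⟩ := hz₁ hn'.symm
      simp [ha, hb, hm, ← hn']
    refine le_of_mul_le_mul_left ?_ (mul_pos hn hn')
    nlinarith [mul_nonneg (sub_nonneg.2 ha) (sub_nonneg.2 hb),
      mul_le_mul_of_nonneg_left h₀ (mul_nonneg hn₁ hn₁),
      mul_le_mul_of_nonneg_left h₁ (mul_nonneg hn₀ hn₀)]
  have hq : 0 ≤ 1 - p := by linarith
  nlinarith [mul_le_mul_of_nonneg_left h₀ (mul_nonneg hq hq),
    mul_le_mul_of_nonneg_left h₁ (mul_nonneg hp₀ hp₀),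
    mul_le_mul_of_nonneg_left key (mul_nonneg hp₀ hq)]

/-- A nonnegative function of a pair of clusters that increases with the first one and decreases
with the second one. -/
structure IncDec (f : Set V → Set V → ℝ) : Prop where
  nonneg : ∀ C D, 0 ≤ f C D
  le : ∀ ⦃C C' D D'⦄, C ⊆ C' → D' ⊆ D → f C D ≤ f C' D'

lemma incDec_indicator {S : Set V → Set V → Prop} [∀ C D, Decidable (S C D)]
    (h : ∀ ⦃C C' D D'⦄, C ⊆ C' → D' ⊆ D → S C D → S C' D') :
    IncDec fun C D => if S C D then 1 else 0 where
  nonneg C D := by split_ifs <;> norm_num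
  le C C' D D' hC hD := by
    have := h hC hD
    split_ifs <;> first | norm_num; done | tauto

/-- Enlarging `T` lowers the conditional expectation of an `IncDec` function given `A ↮ T`,
provided these functions are positively associated given `A ↮ T`. -/
lemma disconnExpec_insert_mul_le (G : PercGraph V E) (hp : G.ProbValid) {F : Finset E}
    {A T : Set V} (v : V)
    (ih : ∀ f g, IncDec f → IncDec g → G.disconnExpec F A T f * G.disconnExpec F A T g ≤
      G.disconnExpec F A T (fun _ _ => 1) * G.disconnExpec F A T (fun C D => f C D * g C D))
    {f : Set V → Set V → ℝ} (hf : IncDec f) :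
    G.disconnExpec F A (insert v T) f * G.disconnExpec F A T (fun _ _ => 1) ≤
      G.disconnExpec F A T f * G.disconnExpec F A (insert v T) (fun _ _ => 1) := by
  classical
  let j : Set V → Set V → ℝ := fun C _ => if v ∈ C then 1 else 0
  have hj : IncDec j := incDec_indicator (S := fun C _ => v ∈ C) fun _ _ _ _ hC _ hv => hC hv
  have one : G.disconnExpec F A (insert v T) (fun _ _ => 1) =
      G.disconnExpec F A T (fun _ _ => 1) - G.disconnExpec F A T j := by
    rw [← disconnExpec_sub]
    refine congrArg G.expec (funext fun ω => ?_)
    by_cases hv : v ∈ G.cluster (restrict F ω) A <;> simp [Set.disjoint_insert_right, hv, j]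
  have le : G.disconnExpec F A (insert v T) f ≤
      G.disconnExpec F A T f - G.disconnExpec F A T (fun C D => f C D * j C D) := by
    rw [← disconnExpec_sub]
    refine G.expec_mono hp fun ω => ?_
    by_cases hv : v ∈ G.cluster (restrict F ω) A
    · simp [Set.disjoint_insert_right, hv, j]
    · simp only [Set.disjoint_insert_right, hv, j, not_false_eq_true, true_and, if_false,
        mul_zero, sub_zero]
      split_ifs
      · exact hf.le subset_rfl (G.cluster_subset_cluster (Set.subset_insert v T))
      · exact le_rfl
  have hn := G.disconnExpec_nonneg hp F A T (h := fun _ _ => 1) fun _ _ => zero_le_one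
  rw [one]
  nlinarith [ih f j hf hj, mul_le_mul_of_nonneg_right le hn]

/-- Given `A ↮ T`, functions increasing in the cluster of `A` and decreasing in the cluster of `T`
are positively correlated. -/
theorem disconnExpec_mul_le (G : PercGraph V E) (hp : G.ProbValid) (F : Finset E) (A T : Set V)
    {f g : Set V → Set V → ℝ} (hf : IncDec f) (hg : IncDec g) :
    G.disconnExpec F A T f * G.disconnExpec F A T g ≤
      G.disconnExpec F A T (fun _ _ => 1) * G.disconnExpec F A T (fun C D => f C D * g C D) := by
  induction F using Finset.strongInduction generalizing T f g with
  | H F ih =>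
  by_cases hF : ∃ e ∈ F, ∃ t ∈ T, ∃ v, G.ends e = (t, v) ∨ G.ends e = (v, t)
  · obtain ⟨e, heF, t, ht, v, he⟩ := hF
    have ih' := ih (F.erase e) (Finset.erase_ssubset heF)
    have cross {h} := G.disconnExpec_insert_mul_le hp v (f := h)
      (fun f g hf hg => ih' T (f := f) (g := g) hf hg)
    have one_nonneg (T : Set V) := G.disconnExpec_nonneg hp (F.erase e) A T
      (h := fun _ _ => 1) fun _ _ => zero_le_one
    simp only [G.disconnExpec_erase heF ht he]
    exact mixture_correlation (hp e).1 (hp e).2 (one_nonneg _) (one_nonneg _)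
      (ih' _ hf hg) (ih' _ hf hg) (cross hf) (cross hg)
      (fun h => ⟨G.disconnExpec_eq_zero hp h _, G.disconnExpec_eq_zero hp h _,
        G.disconnExpec_eq_zero hp h _⟩)
      (fun h => ⟨G.disconnExpec_eq_zero hp h _, G.disconnExpec_eq_zero hp h _,
        G.disconnExpec_eq_zero hp h _⟩)
  · push Not at hF
    have not_adj (ω : E → Bool) (t : V) (ht : t ∈ T) (v : V) : ¬ G.adj (restrict F ω) t v := by
      rintro ⟨e, he, h⟩
      have heF : e ∈ F := by
        simp only [restrict, Bool.and_eq_true, decide_eq_true_eq] at he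
        exact he.2
      rcases h with h | h
      · exact (hF e heF t ht v).1 h
      · exact (hF e heF t ht v).2 h
    have cluster_T (ω : E → Bool) : G.cluster (restrict F ω) T = T :=
      (G.cluster_subset_of_closed subset_rfl fun u hu v huv =>
        absurd huv (not_adj ω u hu v)).antisymm (G.subset_cluster _ _)
    by_cases hAT : Disjoint A T
    · have disj (ω : E → Bool) : Disjoint (G.cluster (restrict F ω) A) T := by
        rw [← Set.subset_compl_iff_disjoint_right] at hAT ⊢
        exact G.cluster_subset_of_closed hAT fun u _ v huv hv =>
          not_adj ω v hv u (G.adj_symm huv)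
      simp only [disconnExpec, disj, if_true, cluster_T]
      refine G.expec_mul_expec_le hp (fun ω => hf.nonneg _ _) (fun ω => hg.nonneg _ _) ?_ ?_
      · exact fun ω ω' h => hf.le (G.cluster_mono (restrict_mono F h) A) subset_rfl
      · exact fun ω ω' h => hg.le (G.cluster_mono (restrict_mono F h) A) subset_rfl
    · have disj (ω : E → Bool) : ¬ Disjoint (G.cluster (restrict F ω) A) T := fun h =>
        hAT (h.mono_left (G.subset_cluster _ _))
      simp [disconnExpec, disj, expec]

lemma restrict_univ (ω : E → Bool) : restrict Finset.univ ω = ω := by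
  ext e
  simp [restrict]

lemma disconnExpec_univ_singleton (G : PercGraph V E) (x y : V) (S : Set V → Set V → Prop)
    [∀ C D, Decidable (S C D)] :
    G.disconnExpec Finset.univ {x} {y} (fun C D => if S C D then 1 else 0) =
      G.prob {ω | ¬ G.Conn ω x y ∧ S (G.cluster ω {x}) (G.cluster ω {y})} := by
  classical
  rw [prob_eq_expec]
  refine congrArg G.expec (funext fun ω => ?_)
  simp only [restrict_univ, Set.disjoint_singleton_right, mem_cluster_singleton,
    Set.indicator_apply, Set.mem_ofPred_eq, Pi.one_apply]
  split_ifs <;> tauto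

/-- Given `x ↮ y`, events increasing in the cluster of `x` and decreasing in the cluster of `y`
are positively correlated. -/
lemma prob_disconn_mul_le (G : PercGraph V E) (hp : G.ProbValid) (x y : V)
    {S S' : Set V → Set V → Prop}
    (hS : ∀ ⦃C C' D D'⦄, C ⊆ C' → D' ⊆ D → S C D → S C' D')
    (hS' : ∀ ⦃C C' D D'⦄, C ⊆ C' → D' ⊆ D → S' C D → S' C' D') :
    G.prob {ω | ¬ G.Conn ω x y ∧ S (G.cluster ω {x}) (G.cluster ω {y})} *
      G.prob {ω | ¬ G.Conn ω x y ∧ S' (G.cluster ω {x}) (G.cluster ω {y})} ≤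
    G.prob {ω | ¬ G.Conn ω x y} *
      G.prob {ω | ¬ G.Conn ω x y ∧ S (G.cluster ω {x}) (G.cluster ω {y}) ∧
        S' (G.cluster ω {x}) (G.cluster ω {y})} := by
  classical
  have h := G.disconnExpec_mul_le hp Finset.univ {x} {y} (incDec_indicator hS)
    (incDec_indicator hS')
  have one := G.disconnExpec_univ_singleton x y fun _ _ => True
  have mul := G.disconnExpec_univ_singleton x y fun C D => S C D ∧ S' C D
  simp only [if_true, and_true] at one
  simp only [ite_zero_mul_ite_zero, mul_one] at h
  rwa [disconnExpec_univ_singleton, disconnExpec_univ_singleton, one, mul] at h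

lemma prob_disconn_same_cluster (G : PercGraph V E) (hp : G.ProbValid) (x y u v : V) :
    G.prob {ω | ¬ G.Conn ω x y ∧ G.Conn ω x u} * G.prob {ω | ¬ G.Conn ω x y ∧ G.Conn ω x v} ≤
    G.prob {ω | ¬ G.Conn ω x y} *
      G.prob {ω | ¬ G.Conn ω x y ∧ G.Conn ω x u ∧ G.Conn ω x v} := by
  have := G.prob_disconn_mul_le hp x y (S := fun C _ => u ∈ C) (S' := fun C _ => v ∈ C)
    (fun _ _ _ _ hC _ h => hC h) (fun _ _ _ _ hC _ h => hC h)
  simpa only [mem_cluster_singleton] using this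

lemma prob_add_prob_of_indicator (G : PercGraph V E) {S S' T T' : Set (E → Bool)}
    (h : ∀ ω, S.indicator (1 : (E → Bool) → ℝ) ω + S'.indicator 1 ω =
      T.indicator (1 : (E → Bool) → ℝ) ω + T'.indicator 1 ω) :
    G.prob S + G.prob S' = G.prob T + G.prob T' := by
  simp only [prob_eq_expec, ← expec_add]
  exact congrArg G.expec (funext h)

lemma prob_disconn_different_clusters (G : PercGraph V E) (hp : G.ProbValid) (x y u v : V) :
    G.prob {ω | ¬ G.Conn ω x y} *
      G.prob {ω | ¬ G.Conn ω x y ∧ G.Conn ω x u ∧ G.Conn ω y v} ≤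
    G.prob {ω | ¬ G.Conn ω x y ∧ G.Conn ω x u} *
      G.prob {ω | ¬ G.Conn ω x y ∧ G.Conn ω y v} := by
  classical
  have h := G.prob_disconn_mul_le hp x y (S := fun C _ => u ∈ C) (S' := fun _ D => v ∉ D)
    (fun _ _ _ _ hC _ h => hC h) (fun _ _ _ _ _ hD h h' => h (hD h'))
  simp only [mem_cluster_singleton] at h
  have split (S : (E → Bool) → Prop) : G.prob {ω | ¬ G.Conn ω x y ∧ S ω} + G.prob ∅ =
      G.prob {ω | ¬ G.Conn ω x y ∧ S ω ∧ G.Conn ω y v} +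
        G.prob {ω | ¬ G.Conn ω x y ∧ S ω ∧ ¬ G.Conn ω y v} := by
    refine G.prob_add_prob_of_indicator fun ω => ?_
    by_cases h₁ : G.Conn ω x y <;> by_cases h₂ : S ω <;> by_cases h₃ : G.Conn ω y v <;>
      simp [h₁, h₂, h₃]
  have empty : G.prob ∅ = 0 := by simp [prob]
  have split_u := split fun ω => G.Conn ω x u
  have split_one := split fun _ => True
  simp only [true_and, and_true, empty, add_zero] at split_u split_one
  linear_combination h - G.prob {ω | ¬ G.Conn ω x y} * split_u +
    G.prob {ω | ¬ G.Conn ω x y ∧ G.Conn ω x u} * split_one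

lemma prob_nonneg (G : PercGraph V E) (hp : G.ProbValid) (S : Set (E → Bool)) : 0 ≤ G.prob S :=
  Finset.sum_nonneg fun ω _ => Set.indicator_nonneg (fun ω _ => G.weight_nonneg hp ω) ω

lemma prob_mono (G : PercGraph V E) (hp : G.ProbValid) {S T : Set (E → Bool)} (h : S ⊆ T) :
    G.prob S ≤ G.prob T :=
  Finset.sum_le_sum fun ω _ => Set.indicator_le_indicator_of_subset h (G.weight_nonneg hp) ω

/-- With `x ↮ y`, the four ways of attaching `u` and `v` to `x` and `y`. -/
lemma prob_disconn_exchange (G : PercGraph V E) (hp : G.ProbValid) (x y u v : V) :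
    G.prob {ω | ¬ G.Conn ω x y ∧ G.Conn ω x u ∧ G.Conn ω y v} *
      G.prob {ω | ¬ G.Conn ω y x ∧ G.Conn ω y u ∧ G.Conn ω x v} ≤
    G.prob {ω | ¬ G.Conn ω x y ∧ G.Conn ω x u ∧ G.Conn ω x v} *
      G.prob {ω | ¬ G.Conn ω y x ∧ G.Conn ω y u ∧ G.Conn ω y v} := by
  have conn_comm (ω : E → Bool) : G.Conn ω y x ↔ G.Conn ω x y := ⟨.symm, .symm⟩
  have same_x := G.prob_disconn_same_cluster hp x y u v
  have same_y := G.prob_disconn_same_cluster hp y x u v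
  have diff_x := G.prob_disconn_different_clusters hp x y u v
  have diff_y := G.prob_disconn_different_clusters hp y x u v
  simp only [conn_comm] at same_y diff_y ⊢
  have hle : G.prob {ω | ¬ G.Conn ω x y ∧ G.Conn ω x u ∧ G.Conn ω y v} ≤
      G.prob {ω | ¬ G.Conn ω x y} := G.prob_mono hp fun ω h => h.1
  have nn := G.prob_nonneg hp
  rcases (nn {ω | ¬ G.Conn ω x y}).eq_or_lt with h₀ | h₀
  · rw [← h₀] at hle
    rw [le_antisymm hle (nn _), zero_mul]
    exact mul_nonneg (nn _) (nn _)
  · refine le_of_mul_le_mul_left ?_ (mul_pos h₀ h₀)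
    have diff := mul_le_mul diff_x diff_y (mul_nonneg h₀.le (nn _)) (mul_nonneg (nn _) (nn _))
    have same := mul_le_mul same_x same_y (mul_nonneg (nn _) (nn _)) (mul_nonneg h₀.le (nn _))
    linarith

/-- The difference between the two sides of the pre-FKG inequality comes from `x ↮ y`. -/
lemma prob_connTo_inter_connEvent (G : PercGraph V E) (o b x y : V) :
    G.prob (G.connTo o {x, y} ∩ G.connEvent x b) +
        G.prob {ω | ¬ G.Conn ω y x ∧ G.Conn ω y o ∧ G.Conn ω y b} =
      G.prob (G.connEvent o b ∩ G.connTo o {x, y}) +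
        G.prob {ω | ¬ G.Conn ω y x ∧ G.Conn ω y o ∧ G.Conn ω x b} := by
  classical
  refine G.prob_add_prob_of_indicator fun ω => ?_
  have equiv : Equivalence (G.Conn ω) := ⟨fun _ => .refl, .symm, .trans⟩
  simp only [Set.indicator_apply, Set.mem_inter_iff, connTo, connEvent, Set.mem_ofPred_eq,
    Set.mem_insert_iff, Set.mem_singleton_iff, exists_eq_or_imp, exists_eq_left, Pi.one_apply]
  generalize G.Conn ω = r at equiv
  have symm {u v} : r u v ↔ r v u := ⟨equiv.symm, equiv.symm⟩
  have trans {u v w} := equiv.trans (x := u) (y := v) (z := w)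
  rw [symm (u := y) (v := o), symm (u := y) (v := x)]
  by_cases hox : r o x
  · have : r o b ↔ r x b := ⟨trans (equiv.symm hox), trans hox⟩
    have : r o y ↔ r x y := ⟨trans (equiv.symm hox), trans hox⟩
    split_ifs <;> first | rfl | (exfalso; tauto)
  · by_cases hoy : r o y
    · have hxy : ¬ r x y := fun h => hox (trans hoy (equiv.symm h))
      have : r o b ↔ r y b := ⟨trans (equiv.symm hoy), trans hoy⟩
      simp only [hox, hoy, hxy, this, or_true, true_and, and_true, not_false_eq_true]
      split_ifs <;> norm_num
    · simp [hox, hoy]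

end Association

end PercGraph

/-- pre-FKG conjecture for `|A| = 2`:
`P(0↔b, 0↔A) ≥ min{P(0↔A, a₁↔b), P(0↔A, a₂↔b)}`. -/
theorem preFKG_two_points
    {V E : Type} [DecidableEq V] [Fintype E] [DecidableEq E]
    (G : PercGraph V E) (hp : G.ProbValid) (x₀ b a₁ a₂ : V) :
    min (G.prob (G.connTo x₀ {a₁, a₂} ∩ G.connEvent a₁ b))
        (G.prob (G.connTo x₀ {a₁, a₂} ∩ G.connEvent a₂ b))
      ≤ G.prob (G.connEvent x₀ b ∩ G.connTo x₀ {a₁, a₂}) := by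
  have h₁ := G.prob_connTo_inter_connEvent x₀ b a₁ a₂
  have h₂ := G.prob_connTo_inter_connEvent x₀ b a₂ a₁
  rw [Set.pair_comm a₂ a₁] at h₂
  have exchange := G.prob_disconn_exchange hp a₁ a₂ x₀ b
  have nn := G.prob_nonneg hp
  by_contra! h
  rw [lt_min_iff] at h
  refine exchange.not_gt (mul_lt_mul'' ?_ ?_ (nn _) (nn _)) <;> linarith
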